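/- arXiv:2210.11436 — 2 statements merged into one kernel-verified Lean document; each statement's English description precedes it below -/
import Mathlib

section
/- For all f, g ∈ F_B^{[α,β]}, the Kullback–Leibler divergence satisfies the lower bound KL(f‖g) ≥ c(α,β) ∫_B (f − g)² dμ, where c(α,β) = h(β/α)/β > 0. -/
open MeasureTheory

/-- The density class `F_B^{[α,β]}`: measurable functions `f : B → ℝ` with
`α ≤ f ≤ β` on `B` and `∫_B f dμ = 1`. -/
def DensityClass {d : ℕ} (μ : Measure (Fin d → ℝ)) (B : Set (Fin d → ℝ))
    (α β : ℝ) : Set ((Fin d → ℝ) → ℝ) :=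
  {f | Measurable f ∧ (∀ x ∈ B, α ≤ f x ∧ f x ≤ β) ∧ ∫ x in B, f x ∂μ = 1}

/-- `h(t) = ((t - 1) - log t)/(t - 1)²` for `t ≠ 1`, and `h(1) = 1/2`. -/
noncomputable def hfun (t : ℝ) : ℝ :=
  if t = 1 then 1 / 2 else ((t - 1) - Real.log t) / (t - 1) ^ 2

/-- `c(α, β) = h(β/α)/β`. -/
noncomputable def cConst (α β : ℝ) : ℝ := hfun (β / α) / β

theorem one_add_mul_sub_one_pos {s t : ℝ} (ht : 0 < t) (hs : s ∈ Set.Icc (0 : ℝ) 1) :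
    0 < 1 + s * (t - 1) := by
  rcases hs.1.eq_or_lt with h0 | h0
  · simp [← h0]
  · nlinarith [hs.2, mul_pos h0 ht]

/-- The function `hfun` as the integral of `s / (1 + s (t - 1))` over `[0, 1]`. -/
theorem hfun_eq_integral {t : ℝ} (ht : 0 < t) :
    hfun t = ∫ s in (0 : ℝ)..1, s / (1 + s * (t - 1)) := by
  unfold hfun
  split_ifs with h
  · subst h
    simp
  · have hu : t - 1 ≠ 0 := sub_ne_zero.2 h
    have hpos : ∀ s ∈ Set.uIcc (0 : ℝ) 1, 0 < 1 + s * (t - 1) := by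
      intro s hs
      rw [Set.uIcc_of_le zero_le_one] at hs
      exact one_add_mul_sub_one_pos ht hs
    have hderiv : ∀ s ∈ Set.uIcc (0 : ℝ) 1,
        HasDerivAt (fun s ↦ s / (t - 1) - Real.log (1 + s * (t - 1)) / (t - 1) ^ 2)
          (s / (1 + s * (t - 1))) s := by
      intro s hs
      have hne := (hpos s hs).ne'
      have hlin : HasDerivAt (fun s : ℝ ↦ 1 + s * (t - 1)) (1 * (t - 1)) s :=
        ((hasDerivAt_id s).mul_const (t - 1)).const_add 1
      refine (((hasDerivAt_id s).div_const (t - 1)).sub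
        ((hlin.log hne).div_const ((t - 1) ^ 2))).congr_deriv ?_
      rw [one_mul, div_div, div_sub_div _ _ hu (by positivity), div_eq_div_iff (by positivity) hne]
      ring
    rw [intervalIntegral.integral_eq_sub_of_hasDerivAt hderiv
      (ContinuousOn.intervalIntegrable
        (ContinuousOn.div (by fun_prop) (by fun_prop) fun s hs ↦ (hpos s hs).ne'))]
    simp only [one_mul, add_sub_cancel, zero_mul, add_zero, Real.log_one, zero_div, sub_zero]
    field_simp

theorem hfun_antitoneOn : AntitoneOn hfun (Set.Ioi 0) := by
  have hint : ∀ t : ℝ, 0 < t →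
      IntervalIntegrable (fun s : ℝ ↦ s / (1 + s * (t - 1))) volume 0 1 := by
    intro t ht
    refine ContinuousOn.intervalIntegrable
      (ContinuousOn.div (by fun_prop) (by fun_prop) fun s hs ↦ (one_add_mul_sub_one_pos ht ?_).ne')
    rwa [Set.uIcc_of_le zero_le_one] at hs
  intro t ht u hu htu
  rw [hfun_eq_integral ht, hfun_eq_integral hu]
  refine intervalIntegral.integral_mono_on zero_le_one (hint u hu) (hint t ht) fun s hs ↦ ?_
  exact div_le_div_of_nonneg_left hs.1 (one_add_mul_sub_one_pos ht hs)
    (by have := mul_le_mul_of_nonneg_left htu hs.1; linarith)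

theorem hfun_pos {t : ℝ} (ht : 0 < t) : 0 < hfun t := by
  unfold hfun
  split_ifs with h
  · norm_num
  · have hlog := Real.log_lt_sub_one_of_pos ht h
    have : t - 1 ≠ 0 := sub_ne_zero.2 h
    exact div_pos (by linarith) (by positivity)

theorem hfun_mul_sq (t : ℝ) : hfun t * (t - 1) ^ 2 = t - 1 - Real.log t := by
  unfold hfun
  split_ifs with h
  · simp [h]
  · have : t - 1 ≠ 0 := sub_ne_zero.2 h
    field_simp

theorem cConst_mul_sq_le {α β a b : ℝ} (hα : 0 < α) (ha : α ≤ a) (haβ : a ≤ β)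
    (hb : α ≤ b) (hbβ : b ≤ β) :
    cConst α β * (a - b) ^ 2 ≤ a * Real.log (a / b) - (a - b) := by
  have ha0 : 0 < a := hα.trans_le ha
  have hb0 : 0 < b := hα.trans_le hb
  have hβ : 0 < β := ha0.trans_le haβ
  have hh : hfun (β / α) ≤ hfun (b / a) :=
    hfun_antitoneOn (div_pos hb0 ha0) (div_pos hβ hα) (by gcongr)
  have hc : cConst α β ≤ hfun (b / a) / a :=
    div_le_div₀ (hfun_pos (div_pos hb0 ha0)).le hh ha0 haβ
  calc cConst α β * (a - b) ^ 2 ≤ hfun (b / a) / a * (a - b) ^ 2 := by gcongr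
    _ = a * (hfun (b / a) * (b / a - 1) ^ 2) := by field_simp; ring
    _ = a * Real.log (a / b) - (a - b) := by
      rw [hfun_mul_sq, Real.log_div hb0.ne' ha0.ne', Real.log_div ha0.ne' hb0.ne']
      field_simp
      ring

/-- Lower bound on the KL divergence over `F_B^{[α,β]}`:
`KL(f‖g) ≥ c(α,β) ∫_B (f - g)² dμ` with `c(α,β) = h(β/α)/β > 0`. -/
theorem kl_ge_L2 {d : ℕ} (μ : Measure (Fin d → ℝ)) [SigmaFinite μ]
    (B : Set (Fin d → ℝ)) (hB : MeasurableSet B) (α β : ℝ)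
    (hα : 0 < α) (hα1 : α ≤ 1) (h1β : 1 ≤ β)
    (f g : (Fin d → ℝ) → ℝ)
    (hf : f ∈ DensityClass μ B α β) (hg : g ∈ DensityClass μ B α β) :
    0 < cConst α β ∧
      cConst α β * (∫ x in B, (f x - g x) ^ 2 ∂μ) ≤
        ∫ x in B, f x * Real.log (f x / g x) ∂μ := by
  have hβ : 0 < β := zero_lt_one.trans_le h1β
  refine ⟨div_pos (hfun_pos (div_pos hβ hα)) hβ, ?_⟩
  obtain ⟨hfm, hfB, hf1⟩ := hf
  obtain ⟨hgm, hgB, hg1⟩ := hg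
  have hfi : IntegrableOn f B μ := .of_integral_ne_zero (by simp [hf1])
  have hgi : IntegrableOn g B μ := .of_integral_ne_zero (by simp [hg1])
  have hsq : IntegrableOn (fun x ↦ (f x - g x) ^ 2) B μ := by
    refine ((hfi.sub hgi).bdd_mul (c := β) (hfm.sub hgm).aestronglyMeasurable ?_).congr
      (.of_forall fun x ↦ (sq (f x - g x)).symm)
    filter_upwards [ae_restrict_mem hB] with x hx
    have := hfB x hx
    have := hgB x hx
    simp only [Pi.sub_apply, Real.norm_eq_abs]
    exact abs_le.2 ⟨by linarith, by linarith⟩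
  have hlog : IntegrableOn (fun x ↦ f x * Real.log (f x / g x)) B μ := by
    refine hfi.mul_bdd (c := Real.log (β / α))
      (hfm.div hgm).log.aestronglyMeasurable ?_
    filter_upwards [ae_restrict_mem hB] with x hx
    obtain ⟨hαf, hfβ⟩ := hfB x hx
    obtain ⟨hαg, hgβ⟩ := hgB x hx
    have hf0 := hα.trans_le hαf
    have hg0 := hα.trans_le hαg
    have h₁ := Real.log_le_log hα hαf
    have h₂ := Real.log_le_log hf0 hfβ
    have h₃ := Real.log_le_log hα hαg
    have h₄ := Real.log_le_log hg0 hgβ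
    rw [Real.norm_eq_abs, Real.log_div hf0.ne' hg0.ne',
      Real.log_div hβ.ne' hα.ne']
    exact abs_le.2 ⟨by linarith, by linarith⟩
  calc cConst α β * ∫ x in B, (f x - g x) ^ 2 ∂μ
      = ∫ x in B, cConst α β * (f x - g x) ^ 2 ∂μ := (integral_const_mul _ _).symm
    _ ≤ ∫ x in B, (f x * Real.log (f x / g x) - (f x - g x)) ∂μ :=
      setIntegral_mono_on (hsq.const_mul _) (hlog.sub (hfi.sub hgi)) hB fun x hx ↦
        cConst_mul_sq_le hα (hfB x hx).1 (hfB x hx).2 (hgB x hx).1 (hgB x hx).2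
    _ = ∫ x in B, f x * Real.log (f x / g x) ∂μ := by
      have hfg : IntegrableOn (fun x ↦ f x - g x) B μ := hfi.sub hgi
      rw [integral_sub hlog hfg, integral_sub hfi hgi, hf1, hg1, sub_self, sub_zero]
end

section
/- Let δ > 0 and let C satisfy C > 1 + √(1/(α c(α,β))). Let g₁, …, g_m ∈ F_B^{[α,β]}, let f ∈ F_B^{[α,β]}, and let k ∈ {1, …, m} be such that ‖g_k − f‖₂ ≤ δ. Let X₁, …, Xₙ be i.i.d. samples from the probability measure with density f with respect to μ. Then the probability that there exists j ∈ {1, …, m} with Σ_{i=1}^n log g_j(Xᵢ) ≥ Σ_{i=1}^n log g_k(Xᵢ) and ‖g_j − g_k‖₂ > Cδ is at most m · exp(−n L(α,β,C) δ²). -/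
open MeasureTheory

/-- `K(α, β) = β/(α² c(α,β))`. -/
noncomputable def Kconst (α β : ℝ) : ℝ := β / (α ^ 2 * cConst α β)

/-- `L(α, β, C) = (√(c(α,β))(C-1) - √(1/α))² / (2(2K(α,β) + (2/3) log(β/α)))`. -/
noncomputable def Lconst (α β C : ℝ) : ℝ :=
  (Real.sqrt (cConst α β) * (C - 1) - Real.sqrt (1 / α)) ^ 2 /
    (2 * (2 * Kconst α β + (2 / 3) * Real.log (β / α)))

/-- Padé bound for the exponential, used in Bernstein's inequality. -/
lemma six_sub_mul_exp_le (x : ℝ) :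
    (6 - 2 * x) * Real.exp x ≤ 6 + 4 * x + x ^ 2 := by
  set F : ℝ → ℝ := fun x => Real.exp (-x) * (6 + 4 * x + x ^ 2) + 2 * x
  have hder : ∀ y, HasDerivAt F (2 - Real.exp (-y) * (2 + 2 * y + y ^ 2)) y := by
    intro y
    have h1 : HasDerivAt (fun y : ℝ => Real.exp (-y)) (Real.exp (-y) * (-1)) y :=
      ((hasDerivAt_id y).neg).exp
    have h2 : HasDerivAt (fun y : ℝ => 6 + 4 * y + y ^ 2) (4 + 2 * y) y := by
      refine ((((hasDerivAt_id y).const_mul 4).const_add 6).add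
        (hasDerivAt_pow 2 y)).congr_deriv ?_
      norm_num
    have h3 : HasDerivAt (fun y : ℝ => 2 * y) 2 y := by
      simpa using (hasDerivAt_id y).const_mul (2 : ℝ)
    exact ((h1.mul h2).add h3).congr_deriv (by ring)
  have hcont : Continuous F := by fun_prop
  have key : 6 ≤ F x := by
    have h0 : F 0 = 6 := by simp [F]
    rw [← h0]
    rcases le_total 0 x with hx | hx
    · refine monotoneOn_of_deriv_nonneg (convex_Ici 0) hcont.continuousOn
        (fun y _ => (hder y).differentiableAt.differentiableWithinAt) ?_
        Set.self_mem_Ici hx hx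
      intro y hy
      rw [interior_Ici] at hy
      rw [(hder y).deriv]
      have h1 := Real.quadratic_le_exp_of_nonneg (le_of_lt hy)
      have h2 : Real.exp (-y) * Real.exp y = 1 := by rw [← Real.exp_add]; simp
      nlinarith [Real.exp_pos (-y)]
    · refine antitoneOn_of_deriv_nonpos (convex_Iic 0) hcont.continuousOn
        (fun y _ => (hder y).differentiableAt.differentiableWithinAt) ?_
        hx Set.self_mem_Iic hx
      intro y hy
      rw [interior_Iic] at hy
      rw [(hder y).deriv]
      have hy' : (0 : ℝ) ≤ -y := by linarith [Set.mem_Iio.mp hy]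
      have h1 := Real.quadratic_le_exp_of_nonneg hy'
      have h2 : 0 < 1 + y + y ^ 2 / 2 := by nlinarith [sq_nonneg (y + 1)]
      have h3 := mul_le_mul_of_nonneg_right h1 h2.le
      nlinarith [pow_nonneg hy' 4]
  have h2 : Real.exp (-x) * Real.exp x = 1 := by rw [← Real.exp_add]; simp
  have h3 := mul_le_mul_of_nonneg_right key (Real.exp_pos x).le
  simp only [F] at h3
  have h4 : (Real.exp (-x) * (6 + 4 * x + x ^ 2) + 2 * x) * Real.exp x =
      (Real.exp (-x) * Real.exp x) * (6 + 4 * x + x ^ 2) + 2 * x * Real.exp x := by ring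
  rw [h4, h2] at h3
  linarith

/-- Bernstein's second-order bound for the exponential. -/
lemma exp_le_one_add_add_sq_div {x y : ℝ} (hxy : x ≤ y) (hy : y < 3) :
    Real.exp x ≤ 1 + x + x ^ 2 / (2 * (1 - y / 3)) := by
  have hy' : 0 < 1 - y / 3 := by linarith
  have h := six_sub_mul_exp_le x
  have hx : 0 < 6 - 2 * x := by linarith
  have h1 : Real.exp x ≤ (6 + 4 * x + x ^ 2) / (6 - 2 * x) := by
    rw [le_div_iff₀ hx]; linarith
  refine h1.trans ?_
  have h2 : (6 + 4 * x + x ^ 2) / (6 - 2 * x) = 1 + x + x ^ 2 / (2 * (1 - x / 3)) := by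
    rw [show 2 * (1 - x / 3) = (6 - 2 * x) / 3 by ring, div_div_eq_mul_div,
      eq_comm, ← sub_eq_zero]
    have := hx.ne'
    generalize hz : 6 - 2 * x = z at this
    obtain rfl : x = (6 - z) / 2 := by linarith
    field_simp
    ring
  rw [h2]
  gcongr

lemma hfun_pos_s13 {T : ℝ} (hT : 0 < T) : 0 < hfun T := by
  unfold hfun
  split_ifs with h
  · norm_num
  · have := Real.log_lt_sub_one_of_pos hT h
    have : T - 1 ≠ 0 := sub_ne_zero.mpr h
    have : 0 < (T - 1) ^ 2 := by positivity
    apply div_pos <;> linarith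

lemma hfun_le_half {T : ℝ} (hT : 1 ≤ T) : hfun T ≤ 1 / 2 := by
  unfold hfun
  split_ifs with h
  · norm_num
  · have hT' : 0 < T - 1 := lt_of_le_of_ne (by linarith) (Ne.symm (sub_ne_zero.mpr h))
    have h1 := Real.le_log_one_add_of_nonneg hT'.le
    rw [div_le_iff₀ (by positivity)]
    have h2 : (T - 1) - (T - 1) ^ 2 / 2 ≤ 2 * (T - 1) / ((T - 1) + 2) := by
      rw [le_div_iff₀ (by linarith)]
      nlinarith [pow_pos hT' 3]
    rw [show 1 + (T - 1) = T by ring] at h1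
    linarith

/-- Quadratic lower bound for `t - 1 - log t` on `(0, T]`. -/
lemma hfun_mul_sq_le {T t : ℝ} (hT : 1 ≤ T) (ht : 0 < t) (htT : t ≤ T) :
    hfun T * (t - 1) ^ 2 ≤ t - 1 - Real.log t := by
  have ha := hfun_pos_s13 (zero_lt_one.trans_le hT)
  have ha2 := hfun_le_half hT
  set a := hfun T with haT
  have hφT : a * (T - 1) ^ 2 ≤ T - 1 - Real.log T := by
    rcases eq_or_ne T 1 with h | h
    · simp [h]
    · have : T - 1 ≠ 0 := sub_ne_zero.mpr h
      rw [haT, hfun, if_neg h, div_mul_cancel₀ _ (by positivity)]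
  set F : ℝ → ℝ := fun t => t - 1 - Real.log t - a * (t - 1) ^ 2
  have hder : ∀ y, 0 < y → HasDerivAt F ((y - 1) * (y⁻¹ - 2 * a)) y := by
    intro y hy
    have h1 : HasDerivAt (fun t : ℝ => t - 1) 1 y := (hasDerivAt_id y).sub_const 1
    refine ((h1.sub (Real.hasDerivAt_log hy.ne')).sub ((h1.pow 2).const_mul a)).congr_deriv ?_
    field_simp
    ring
  have hcont : ∀ {s : Set ℝ}, s ⊆ Set.Ioi 0 → ContinuousOn F s := fun hs y hy =>
    (hder y (hs hy)).continuousAt.continuousWithinAt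
  have hdiff : ∀ {s : Set ℝ}, s ⊆ Set.Ioi 0 → DifferentiableOn ℝ F s := fun hs y hy =>
    (hder y (hs hy)).differentiableAt.differentiableWithinAt
  have hF1 : F 1 = 0 := by simp [F]
  have hp : 1 ≤ (2 * a)⁻¹ := by
    rw [one_le_inv₀ (by positivity)]; linarith
  have hle : ∀ y, 0 < y → y ≤ (2 * a)⁻¹ → 0 ≤ y⁻¹ - 2 * a := fun y hy h => by
    have := (le_inv_comm₀ hy (by positivity)).mp h
    linarith
  suffices 0 ≤ F t by simp only [F] at this; linarith
  rcases le_total t 1 with h1 | h1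
  · rw [← hF1]
    have hs : Set.Ioc (0 : ℝ) 1 ⊆ Set.Ioi 0 := fun y hy => hy.1
    refine antitoneOn_of_deriv_nonpos (convex_Ioc 0 1) (hcont hs)
      (hdiff (interior_subset.trans hs)) ?_ ⟨ht, h1⟩ ⟨one_pos, le_rfl⟩ h1
    intro y hy
    rw [interior_Ioc] at hy
    rw [(hder y hy.1).deriv]
    exact mul_nonpos_of_nonpos_of_nonneg (by linarith [hy.2])
      (hle y hy.1 (hy.2.le.trans hp))
  rcases le_total t (2 * a)⁻¹ with h2 | h2
  · rw [← hF1]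
    have hs : Set.Icc 1 (2 * a)⁻¹ ⊆ Set.Ioi 0 := fun y hy => one_pos.trans_le hy.1
    refine monotoneOn_of_deriv_nonneg (convex_Icc 1 (2 * a)⁻¹) (hcont hs)
      (hdiff (interior_subset.trans hs)) ?_ ⟨le_rfl, hp⟩ ⟨h1, h2⟩ h1
    intro y hy
    rw [interior_Icc] at hy
    have hy0 : 0 < y := one_pos.trans hy.1
    rw [(hder y hy0).deriv]
    exact mul_nonneg (by linarith [hy.1]) (hle y hy0 hy.2.le)
  · have hT0 : 0 ≤ F T := by simp only [F]; linarith
    refine hT0.trans ?_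
    have hs : Set.Ici (2 * a)⁻¹ ⊆ Set.Ioi 0 := fun y hy => one_pos.trans_le (hp.trans hy)
    refine antitoneOn_of_deriv_nonpos (convex_Ici (2 * a)⁻¹) (hcont hs)
      (hdiff (interior_subset.trans hs)) ?_ h2 (h2.trans htT) htT
    intro y hy
    rw [interior_Ici] at hy
    have hy1 : (2 * a)⁻¹ < y := hy
    have hy0 : 0 < y := one_pos.trans (hp.trans_lt hy1)
    rw [(hder y hy0).deriv]
    have := (inv_le_comm₀ (by positivity) hy0).mp hy1.le
    exact mul_nonpos_of_nonneg_of_nonpos (by linarith) (by linarith)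

lemma sq_log_sub_log_le {α x y : ℝ} (hα : 0 < α) (hx : α ≤ x) (hy : α ≤ y) :
    (Real.log x - Real.log y) ^ 2 ≤ (x - y) ^ 2 / α ^ 2 := by
  have main : ∀ {x y : ℝ}, α ≤ y → y ≤ x →
      (Real.log x - Real.log y) ^ 2 ≤ (x - y) ^ 2 / α ^ 2 := by
    intro x y hy hxy
    have hy0 := hα.trans_le hy
    have hx0 := hy0.trans_le hxy
    rw [← div_pow]
    have h0 : 0 ≤ Real.log x - Real.log y := sub_nonneg.mpr (Real.log_le_log hy0 hxy)
    have h1 : Real.log x - Real.log y ≤ (x - y) / α := by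
      rw [← Real.log_div hx0.ne' hy0.ne']
      calc Real.log (x / y) ≤ x / y - 1 := Real.log_le_sub_one_of_pos (by positivity)
        _ = (x - y) / y := by field_simp
        _ ≤ (x - y) / α := div_le_div_of_nonneg_left (by linarith) hα hy
    gcongr
  rcases le_total y x with h | h
  · exact main hy h
  · have := main hx h
    rwa [sub_sq_comm x y, sub_sq_comm (Real.log x) (Real.log y)]

/-- Pointwise comparison of the log-likelihood ratio with squared distances. -/
lemma mul_log_sub_log_le {α β p q r : ℝ} (hα : 0 < α)
    (hp : α ≤ p ∧ p ≤ β) (hq : α ≤ q ∧ q ≤ β) (hr : α ≤ r ∧ r ≤ β) :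
    p * (Real.log r - Real.log q) ≤
      (q - p) ^ 2 / α - cConst α β * (r - p) ^ 2 + (r - q) := by
  have hp0 := hα.trans_le hp.1
  have hq0 := hα.trans_le hq.1
  have hr0 := hα.trans_le hr.1
  have hβ := hp0.trans_le hp.2
  have hT : 1 ≤ β / α := by rw [one_le_div hα]; linarith
  have h1 : p * (Real.log p - Real.log q) ≤ (q - p) ^ 2 / α + (p - q) := by
    rw [← Real.log_div hp0.ne' hq0.ne']
    calc p * Real.log (p / q) ≤ p * (p / q - 1) := by
          gcongr; exact Real.log_le_sub_one_of_pos (by positivity)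
      _ = (q - p) ^ 2 / q + (p - q) := by field_simp; ring
      _ ≤ _ := by gcongr; exact hq.1
  have h2 : p * (Real.log r - Real.log p) ≤ (r - p) - cConst α β * (r - p) ^ 2 := by
    rw [← Real.log_div hr0.ne' hp0.ne']
    have hle : r / p ≤ β / α := div_le_div₀ hβ.le hr.2 hα hp.1
    have h3 := hfun_mul_sq_le hT (div_pos hr0 hp0) hle
    have hh := hfun_pos_s13 (zero_lt_one.trans_le hT)
    calc p * Real.log (r / p)
        ≤ p * (r / p - 1 - hfun (β / α) * (r / p - 1) ^ 2) := by gcongr; linarith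
      _ = (r - p) - hfun (β / α) * (r - p) ^ 2 / p := by field_simp
      _ ≤ (r - p) - hfun (β / α) * (r - p) ^ 2 / β := by gcongr; exact hp.2
      _ = _ := by rw [cConst]; ring
  linarith

open ProbabilityTheory in
/-- Chernoff bound for sums of i.i.d. variables on a product space. -/
lemma pi_measure_sum_nonneg_le {Ω : Type*} [MeasurableSpace Ω] (ν : Measure Ω)
    [IsProbabilityMeasure ν] {V : Ω → ℝ} (hV : Measurable V) {s : ℝ} (hs : 0 ≤ s) (n : ℕ) :
    (Measure.pi fun _ : Fin n => ν) {X | 0 ≤ ∑ i, V (X i)} ≤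
      (∫⁻ x, ENNReal.ofReal (Real.exp (s * V x)) ∂ν) ^ n := by
  set φ : Ω → ENNReal := fun x => ENNReal.ofReal (Real.exp (s * V x))
  have hφ : Measurable φ := by fun_prop
  have hsub : {X : Fin n → Ω | 0 ≤ ∑ i, V (X i)} ⊆ {X | 1 ≤ ∏ i, φ (X i)} := by
    intro X hX
    have hX' : 0 ≤ ∑ i, V (X i) := hX
    simp only [φ, Set.mem_ofPred_eq]
    rw [← ENNReal.ofReal_prod_of_nonneg (fun i _ => (Real.exp_pos _).le), ← Real.exp_sum,
      ← Finset.mul_sum, ENNReal.one_le_ofReal, Real.one_le_exp_iff]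
    positivity
  refine (measure_mono hsub).trans ?_
  have hmeas : Measurable fun X : Fin n → Ω => ∏ i, φ (X i) := by fun_prop
  have hmk := mul_meas_ge_le_lintegral (μ := Measure.pi fun _ : Fin n => ν) hmeas 1
  rw [one_mul] at hmk
  refine hmk.trans_eq ?_
  have hind : iIndepFun (fun i (X : Fin n → Ω) => φ (X i)) (Measure.pi fun _ : Fin n => ν) :=
    iIndepFun_pi fun _ => hφ.aemeasurable
  rw [lintegral_prod_eq_prod_lintegral_of_indepFun _ _ hind fun i => by fun_prop]
  have heval : ∀ i : Fin n,
      ∫⁻ X : Fin n → Ω, φ (X i) ∂(Measure.pi fun _ : Fin n => ν) = ∫⁻ x, φ x ∂ν := fun i =>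
    (measurePreserving_eval (fun _ : Fin n => ν) i).lintegral_comp hφ
  simp [heval]

/-- Minkowski's inequality in `L²`, phrased through squared integrals. -/
lemma integral_add_sq_le {Ω : Type*} [MeasurableSpace Ω] {ν : Measure Ω} {u v w : Ω → ℝ}
    {a b : ℝ} (ha : 0 < a) (hb : 0 < b) (hw : ∀ x, w x = u x + v x)
    (hu : Integrable (fun x => u x ^ 2) ν) (hv : Integrable (fun x => v x ^ 2) ν)
    (hua : ∫ x, u x ^ 2 ∂ν ≤ a ^ 2) (hvb : ∫ x, v x ^ 2 ∂ν ≤ b ^ 2) :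
    ∫ x, w x ^ 2 ∂ν ≤ (a + b) ^ 2 := by
  have hpt : ∀ x, w x ^ 2 ≤ (a + b) / a * u x ^ 2 + (a + b) / b * v x ^ 2 := by
    intro x
    have : (a + b) / a * u x ^ 2 + (a + b) / b * v x ^ 2 - w x ^ 2
        = (b * u x - a * v x) ^ 2 / (a * b) := by rw [hw]; field_simp; ring
    have : 0 ≤ (b * u x - a * v x) ^ 2 / (a * b) := by positivity
    linarith
  calc ∫ x, w x ^ 2 ∂ν
      ≤ ∫ x, ((a + b) / a * u x ^ 2 + (a + b) / b * v x ^ 2) ∂ν :=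
        integral_mono_of_nonneg (ae_of_all _ fun x => sq_nonneg _)
          ((hu.const_mul _).add (hv.const_mul _)) (ae_of_all _ hpt)
    _ = (a + b) / a * ∫ x, u x ^ 2 ∂ν + (a + b) / b * ∫ x, v x ^ 2 ∂ν := by
        rw [integral_add (hu.const_mul _) (hv.const_mul _), integral_const_mul,
          integral_const_mul]
    _ ≤ (a + b) / a * a ^ 2 + (a + b) / b * b ^ 2 := by gcongr
    _ = (a + b) ^ 2 := by field_simp

/-- Optimisation of the exponent in Bernstein's inequality. -/
lemma exists_bernstein_exponent {u w K M D δ e : ℝ} (hu : 0 < u) (huw : u ≤ w)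
    (hK : 0 < K) (hM : 0 ≤ M) (hδ : 0 < δ) (he : w < u * e) (hD : e * δ ≤ D) :
    ∃ s : ℝ, 0 ≤ s ∧ s * M < 3 ∧ ∀ I J : ℝ, I ≤ w ^ 2 * δ ^ 2 - u ^ 2 * D ^ 2 →
      J ≤ K * (u * (D + δ)) ^ 2 →
      s * I + s ^ 2 / (2 * (1 - s * M / 3)) * J ≤
        -((u * e - w) ^ 2 / (2 * (2 * K + (2 / 3) * M))) * δ ^ 2 := by
  have hw : 0 < w := hu.trans_le huw
  have he0 : 0 < e := by
    by_contra h
    nlinarith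
  have hD0 : 0 < D := (mul_pos he0 hδ).trans_le hD
  set A := u * D + w * δ with hA
  set b := u * D - w * δ with hb
  have hb1 : (u * e - w) * δ ≤ b := by
    have := mul_le_mul_of_nonneg_left hD hu.le
    rw [hb]; linarith
  have hb0 : 0 < b := (mul_pos (by linarith) hδ).trans_le hb1
  have hbA : b ≤ A := by nlinarith
  have hA0 : 0 < A := hb0.trans_le hbA
  have hAD : u * (D + δ) ≤ A := by
    have := mul_le_mul_of_nonneg_right huw hδ.le
    rw [hA]; linarith
  set Q := K * A + M * b / 3 with hQ
  have hQ0 : 0 < Q := by positivity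
  have hKA : 0 < K * A := by positivity
  refine ⟨b / Q, by positivity, ?_, ?_⟩
  · rw [div_mul_eq_mul_div, div_lt_iff₀ hQ0]
    linarith
  intro I J hI hJ
  have hs : 1 - b / Q * M / 3 = K * A / Q := by
    field_simp
    rw [hQ]; ring
  have hJ' : J ≤ K * A ^ 2 := hJ.trans (by gcongr)
  have hI' : I ≤ -(A * b) := hI.trans_eq (by rw [hA, hb]; ring)
  rw [hs]
  calc b / Q * I + (b / Q) ^ 2 / (2 * (K * A / Q)) * J
      ≤ b / Q * (-(A * b)) + (b / Q) ^ 2 / (2 * (K * A / Q)) * (K * A ^ 2) := by gcongr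
    _ = -(b ^ 2 / (2 * (Q / A))) := by
        field_simp
        ring
    _ ≤ -(((u * e - w) * δ) ^ 2 / (2 * (2 * K + (2 / 3) * M))) := by
        have h1 : Q / A ≤ 2 * K + (2 / 3) * M := by
          rw [div_le_iff₀ hA0, hQ]
          nlinarith [mul_le_mul_of_nonneg_left hbA hM, mul_nonneg hM hA0.le]
        have h2 : 0 ≤ (u * e - w) * δ := (mul_pos (by linarith) hδ).le
        have h3 : 0 < Q / A := by positivity
        apply neg_le_neg
        gcongr
    _ = _ := by ring

lemma cConst_pos {α β : ℝ} (hα : 0 < α) (hβ : 0 < β) : 0 < cConst α β :=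
  div_pos (hfun_pos_s13 (by positivity)) hβ

lemma cConst_le_inv {α β : ℝ} (hα : 0 < α) (hαβ : α ≤ β) : cConst α β ≤ 1 / α := by
  have h := hfun_le_half ((one_le_div hα).mpr hαβ)
  exact div_le_div₀ zero_le_one (by linarith) hα hαβ

/-- Exponential moment bound for the log-likelihood ratio of a density `r` far from `q`,
under a density `p` close to `q`. -/
lemma exists_lintegral_exp_log_sub_log_le {Ω : Type*} [MeasurableSpace Ω] {ν : Measure Ω}
    [IsFiniteMeasure ν] {α β δ C : ℝ} (hα : 0 < α) (hαβ : α ≤ β) (hδ : 0 < δ)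
    (hC : 1 + Real.sqrt (1 / (α * cConst α β)) < C) {p q r : Ω → ℝ}
    (hpm : Measurable p) (hqm : Measurable q) (hrm : Measurable r)
    (hp : ∀ᵐ x ∂ν, α ≤ p x ∧ p x ≤ β) (hq : ∀ᵐ x ∂ν, α ≤ q x ∧ q x ≤ β)
    (hr : ∀ᵐ x ∂ν, α ≤ r x ∧ r x ≤ β)
    (hp1 : ∫ x, p x ∂ν = 1) (hq1 : ∫ x, q x ∂ν = 1) (hr1 : ∫ x, r x ∂ν = 1)
    (hqp : ∫ x, (q x - p x) ^ 2 ∂ν ≤ δ ^ 2)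
    (hrq : (C * δ) ^ 2 < ∫ x, (r x - q x) ^ 2 ∂ν) :
    ∃ s : ℝ, 0 ≤ s ∧
      ∫⁻ x, ENNReal.ofReal (Real.exp (s * (Real.log (r x) - Real.log (q x))))
        ∂(ν.withDensity fun x => ENNReal.ofReal (p x)) ≤
      ENNReal.ofReal (Real.exp (-Lconst α β C * δ ^ 2)) := by
  have hβ : 0 < β := hα.trans_le hαβ
  have hc := cConst_pos hα hβ
  set c := cConst α β with hcdef
  have integrable_dens : ∀ {v : Ω → ℝ}, Measurable v → (∀ᵐ x ∂ν, α ≤ v x ∧ v x ≤ β) →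
      Integrable v ν := fun hvm hv =>
    Integrable.of_bound hvm.aestronglyMeasurable β <| by
      filter_upwards [hv] with x hx
      rw [Real.norm_eq_abs, abs_of_nonneg (hα.le.trans hx.1)]
      exact hx.2
  have integrable_sq_sub : ∀ {v v' : Ω → ℝ}, Measurable v → Measurable v' →
      (∀ᵐ x ∂ν, α ≤ v x ∧ v x ≤ β) → (∀ᵐ x ∂ν, α ≤ v' x ∧ v' x ≤ β) →
      Integrable (fun x => (v x - v' x) ^ 2) ν := fun hvm hvm' hv hv' =>
    Integrable.of_bound ((hvm.sub hvm').pow_const 2).aestronglyMeasurable (β ^ 2) <| by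
      filter_upwards [hv, hv'] with x hx hx'
      rw [Real.norm_eq_abs, abs_of_nonneg (sq_nonneg _)]
      exact sq_le_sq' (by linarith) (by linarith)
  have ipq := integrable_sq_sub hqm hpm hq hp
  have ipq' := integrable_sq_sub hpm hqm hp hq
  have irp := integrable_sq_sub hrm hpm hr hp
  have irq := integrable_sq_sub hrm hqm hr hq
  have hpq : ∫ x, (p x - q x) ^ 2 ∂ν ≤ δ ^ 2 := by
    simpa only [sub_sq_comm] using hqp
  set D := Real.sqrt (∫ x, (r x - p x) ^ 2 ∂ν) with hD
  have hDsq : D ^ 2 = ∫ x, (r x - p x) ^ 2 ∂ν :=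
    Real.sq_sqrt (integral_nonneg fun x => sq_nonneg _)
  have he : 0 < C - 1 := by
    have := Real.sqrt_nonneg (1 / (α * c))
    linarith
  have hDge : (C - 1) * δ ≤ D := by
    by_contra! hlt
    have h1 : ∫ x, (r x - p x) ^ 2 ∂ν ≤ ((C - 1) * δ) ^ 2 := by
      rw [← hDsq]
      exact pow_le_pow_left₀ (Real.sqrt_nonneg _) hlt.le 2
    have h2 := integral_add_sq_le (mul_pos he hδ) hδ
      (fun x => (sub_add_sub_cancel (r x) (p x) (q x)).symm) irp ipq' h1 hpq
    rw [show (C - 1) * δ + δ = C * δ by ring] at h2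
    linarith
  have hD0 : 0 < D := (mul_pos he hδ).trans_le hDge
  have hJ := integral_add_sq_le hD0 hδ
      (fun x => (sub_add_sub_cancel (r x) (p x) (q x)).symm) irp ipq' hDsq.ge hpq
  have hu : 0 < Real.sqrt c := Real.sqrt_pos.mpr hc
  have huw : Real.sqrt c ≤ Real.sqrt (1 / α) := Real.sqrt_le_sqrt (cConst_le_inv hα hαβ)
  have hew : Real.sqrt (1 / α) < Real.sqrt c * (C - 1) := by
    calc Real.sqrt (1 / α) = Real.sqrt c * Real.sqrt (1 / (α * c)) := by
          rw [← Real.sqrt_mul hc.le]; congr 1; field_simp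
      _ < _ := by gcongr; linarith
  have hK : 0 < Kconst α β := div_pos hβ (mul_pos (by positivity) hc)
  set M := Real.log (β / α)
  have hM : 0 ≤ M := Real.log_nonneg ((one_le_div hα).mpr hαβ)
  obtain ⟨s, hs0, hsM, hs⟩ := exists_bernstein_exponent hu huw hK hM hδ hew hDge
  refine ⟨s, hs0, ?_⟩
  set κ := s ^ 2 / (2 * (1 - s * M / 3))
  have hκ : 0 ≤ κ := by
    have : 0 < 1 - s * M / 3 := by linarith
    positivity
  set I : Ω → ℝ := fun x => (q x - p x) ^ 2 / α - c * (r x - p x) ^ 2 + (r x - q x)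
  set J : Ω → ℝ := fun x => β / α ^ 2 * (r x - q x) ^ 2
  have ip := integrable_dens hpm hp
  have irq1 : Integrable (fun x => r x - q x) ν :=
    (integrable_dens hrm hr).sub (integrable_dens hqm hq)
  have iI2 : Integrable (fun x => (q x - p x) ^ 2 / α - c * (r x - p x) ^ 2) ν :=
    (ipq.div_const _).sub (irp.const_mul _)
  have iI : Integrable I ν := iI2.add irq1
  have iJ : Integrable J ν := irq.const_mul _
  have hI : ∫ x, I x ∂ν ≤ Real.sqrt (1 / α) ^ 2 * δ ^ 2 - Real.sqrt c ^ 2 * D ^ 2 := by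
    rw [Real.sq_sqrt (by positivity), Real.sq_sqrt hc.le, hDsq]
    have : ∫ x, I x ∂ν =
        (∫ x, (q x - p x) ^ 2 ∂ν) / α - c * (∫ x, (r x - p x) ^ 2 ∂ν) := by
      simp only [I]
      rw [integral_add iI2 irq1, integral_sub (ipq.div_const _) (irp.const_mul _),
        integral_sub (integrable_dens hrm hr) (integrable_dens hqm hq),
        integral_div, integral_const_mul, hr1, hq1]
      ring
    rw [this, one_div, inv_mul_eq_div]
    gcongr
  have hJ' : ∫ x, J x ∂ν ≤ Kconst α β * (Real.sqrt c * (D + δ)) ^ 2 := by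
    simp only [J]
    rw [integral_const_mul, mul_pow, Real.sq_sqrt hc.le, Kconst, ← hcdef]
    calc β / α ^ 2 * ∫ x, (r x - q x) ^ 2 ∂ν ≤ β / α ^ 2 * (D + δ) ^ 2 := by gcongr
      _ = _ := by field_simp
  have hpt : ∀ᵐ x ∂ν, p x * Real.exp (s * (Real.log (r x) - Real.log (q x))) ≤
      p x + s * I x + κ * J x := by
    filter_upwards [hp, hq, hr] with x hpx hqx hrx
    set V := Real.log (r x) - Real.log (q x)
    have hp0 : 0 < p x := hα.trans_le hpx.1
    have hVM : V ≤ M := by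
      have hq0 := hα.trans_le hqx.1
      have hr0 := hα.trans_le hrx.1
      simp only [V, M]
      rw [← Real.log_div hr0.ne' hq0.ne']
      exact Real.log_le_log (by positivity) (div_le_div₀ hβ.le hrx.2 hα hqx.1)
    have h1 := exp_le_one_add_add_sq_div (mul_le_mul_of_nonneg_left hVM hs0) hsM
    have h2 : p x * V ≤ I x := mul_log_sub_log_le hα hpx hqx hrx
    have h3 : p x * V ^ 2 ≤ J x := by
      calc p x * V ^ 2 ≤ β * ((r x - q x) ^ 2 / α ^ 2) :=
            mul_le_mul hpx.2 (sq_log_sub_log_le hα hrx.1 hqx.1) (sq_nonneg _) hβ.le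
        _ = J x := by simp only [J]; ring
    calc p x * Real.exp (s * V) ≤ p x * (1 + s * V + (s * V) ^ 2 / (2 * (1 - s * M / 3))) := by
          gcongr
      _ = p x + s * (p x * V) + κ * (p x * V ^ 2) := by simp only [κ]; ring
      _ ≤ _ := by gcongr
  have iG : Integrable (fun x => p x + s * I x) ν := ip.add (iI.const_mul s)
  have hG : Integrable (fun x => p x + s * I x + κ * J x) ν := iG.add (iJ.const_mul κ)
  have hpexp : ∀ᵐ x ∂ν, 0 ≤ p x + s * I x + κ * J x := by
    filter_upwards [hpt, hp] with x hx hpx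
    exact (mul_nonneg (hα.le.trans hpx.1) (Real.exp_pos _).le).trans hx
  rw [lintegral_withDensity_eq_lintegral_mul _ (by fun_prop) (by fun_prop)]
  calc _ ≤ ∫⁻ x, ENNReal.ofReal (p x + s * I x + κ * J x) ∂ν := by
        refine lintegral_mono_ae ?_
        filter_upwards [hpt, hp] with x hx hpx
        rw [Pi.mul_apply, ← ENNReal.ofReal_mul (hα.le.trans hpx.1)]
        exact ENNReal.ofReal_le_ofReal hx
    _ = ENNReal.ofReal (∫ x, (p x + s * I x + κ * J x) ∂ν) :=
        (ofReal_integral_eq_lintegral_ofReal hG hpexp).symm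
    _ ≤ _ := by
        apply ENNReal.ofReal_le_ofReal
        rw [integral_add iG (iJ.const_mul κ), integral_add ip (iI.const_mul s),
          integral_const_mul, integral_const_mul, hp1]
        have h := hs _ _ hI hJ'
        have h2 := Real.add_one_le_exp (-Lconst α β C * δ ^ 2)
        rw [Lconst, ← hcdef] at h2 ⊢
        linarith

/-- Concentration over a packing set: if `‖g_k - f‖₂ ≤ δ`, the probability under
`n` i.i.d. samples from the density `f` that some `j` has at least the likelihood
of `g_k` while `‖g_j - g_k‖₂ > Cδ` is at most `m · exp(-n L(α,β,C) δ²)`. -/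
theorem packing_logLikelihood_concentration {d : ℕ} (μ : Measure (Fin d → ℝ))
    [SigmaFinite μ] (B : Set (Fin d → ℝ)) (hB : MeasurableSet B) (α β : ℝ)
    (hα : 0 < α) (hα1 : α ≤ 1) (h1β : 1 ≤ β)
    (δ : ℝ) (hδ : 0 < δ) (C : ℝ)
    (hC : 1 + Real.sqrt (1 / (α * cConst α β)) < C)
    (m : ℕ) (g : Fin m → (Fin d → ℝ) → ℝ)
    (hg : ∀ j, g j ∈ DensityClass μ B α β)
    (f : (Fin d → ℝ) → ℝ) (hf : f ∈ DensityClass μ B α β)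
    (k : Fin m) (hk : Real.sqrt (∫ x in B, (g k x - f x) ^ 2 ∂μ) ≤ δ)
    (n : ℕ) :
    (Measure.pi fun _ : Fin n =>
        (μ.restrict B).withDensity fun y => ENNReal.ofReal (f y))
      {X : Fin n → Fin d → ℝ | ∃ j : Fin m,
        (∑ i, Real.log (g k (X i))) ≤ (∑ i, Real.log (g j (X i))) ∧
        C * δ < Real.sqrt (∫ x in B, (g j x - g k x) ^ 2 ∂μ)} ≤
      (m : ENNReal) * ENNReal.ofReal (Real.exp (-(n : ℝ) * Lconst α β C * δ ^ 2)) := by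
  have hαβ : α ≤ β := hα1.trans h1β
  have hbd : ∀ {v}, v ∈ DensityClass μ B α β → ∀ᵐ x ∂μ.restrict B, α ≤ v x ∧ v x ≤ β :=
    fun hv => (ae_restrict_iff' hB).mpr (ae_of_all _ hv.2.1)
  have hfint : Integrable f (μ.restrict B) := by
    by_contra h
    have := hf.2.2
    rw [integral_undef h] at this
    exact zero_ne_one this
  have : IsFiniteMeasure (μ.restrict B) := by
    have : Integrable (fun _ => α) (μ.restrict B) :=
      hfint.mono aestronglyMeasurable_const <| by
        filter_upwards [hbd hf] with x hx
        rw [Real.norm_eq_abs, Real.norm_eq_abs, abs_of_pos hα]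
        exact hx.1.trans (le_abs_self _)
    exact (integrable_const_iff_isFiniteMeasure hα.ne').mp this
  set ν := (μ.restrict B).withDensity fun y => ENNReal.ofReal (f y) with hν
  have : IsProbabilityMeasure ν := ⟨by
    rw [hν, withDensity_apply _ MeasurableSet.univ, Measure.restrict_univ,
      ← ofReal_integral_eq_lintegral_ofReal hfint, hf.2.2, ENNReal.ofReal_one]
    filter_upwards [hbd hf] with x hx using hα.le.trans hx.1⟩
  have hqp : ∫ x in B, (g k x - f x) ^ 2 ∂μ ≤ δ ^ 2 := (Real.sqrt_le_left hδ.le).mp hk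
  have hone : ∀ j : Fin m, (Measure.pi fun _ : Fin n => ν) {X : Fin n → Fin d → ℝ |
      (∑ i, Real.log (g k (X i))) ≤ (∑ i, Real.log (g j (X i))) ∧
        C * δ < Real.sqrt (∫ x in B, (g j x - g k x) ^ 2 ∂μ)} ≤
      ENNReal.ofReal (Real.exp (-(n : ℝ) * Lconst α β C * δ ^ 2)) := by
    intro j
    by_cases hj : C * δ < Real.sqrt (∫ x in B, (g j x - g k x) ^ 2 ∂μ)
    · have hCδ : 0 ≤ C * δ := by
        have := Real.sqrt_nonneg (1 / (α * cConst α β))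
        exact mul_nonneg (by linarith) hδ.le
      obtain ⟨s, hs0, hs⟩ := exists_lintegral_exp_log_sub_log_le hα hαβ hδ hC hf.1 (hg k).1
        (hg j).1 (hbd hf) (hbd (hg k)) (hbd (hg j)) hf.2.2 (hg k).2.2 (hg j).2.2 hqp
        ((Real.lt_sqrt hCδ).mp hj)
      have hV : Measurable fun x => Real.log (g j x) - Real.log (g k x) :=
        (hg j).1.log.sub (hg k).1.log
      calc _ ≤ (Measure.pi fun _ : Fin n => ν)
            {X | 0 ≤ ∑ i, (Real.log (g j (X i)) - Real.log (g k (X i)))} := by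
            refine measure_mono fun X hX => ?_
            rw [Set.mem_ofPred_eq, Finset.sum_sub_distrib, sub_nonneg]
            exact hX.1
        _ ≤ _ := pi_measure_sum_nonneg_le ν hV hs0 n
        _ ≤ ENNReal.ofReal (Real.exp (-Lconst α β C * δ ^ 2)) ^ n := pow_le_pow_left' hs n
        _ = _ := by
            rw [← ENNReal.ofReal_pow (Real.exp_pos _).le, ← Real.exp_nat_mul]
            congr 2
            ring
    · simp [hj]
  rw [Set.ofPred_exists]
  calc _ ≤ ∑ j : Fin m, _ := measure_iUnion_fintype_le _ _
    _ ≤ ∑ _j : Fin m, ENNReal.ofReal (Real.exp (-(n : ℝ) * Lconst α β C * δ ^ 2)) :=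
        Finset.sum_le_sum fun j _ => hone j
    _ = _ := by simp
end
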